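/- No 2-nested enriched matrix contains D_1 or D_5, or their dual matrices, as a subconfiguration. In particular, neither D_1 nor D_5 admits a total block bi-coloring. -/

import Mathlib

/-- Labels for rows of an enriched matrix. -/
inductive RowLabel : Type
  | L | R | LR
deriving DecidableEq

/-- Colors for rows/blocks of an enriched matrix. -/
inductive RowColor : Type
  | red | blue
deriving DecidableEq

/-- An enriched matrix: a (0,1)-matrix whose rows may carry an optional label in
{L, R, LR} and an optional color in {red, blue}, where only L-rows, R-rows and
all-zero LR-rows may be colored, and all colored all-zero LR-rows have the same
color. -/
structure EnrichedMatrix (m n : ℕ) : Type where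
  entry : Fin m → Fin n → Bool
  label : Fin m → Option RowLabel
  color : Fin m → Option RowColor
  color_rows : ∀ i, (color i).isSome = true →
    label i = some RowLabel.L ∨ label i = some RowLabel.R ∨
      (label i = some RowLabel.LR ∧ ∀ j, entry i j = false)
  lr_color_unique : ∀ i k, label i = some RowLabel.LR → label k = some RowLabel.LR →
    (color i).isSome = true → (color k).isSome = true → color i = color k

namespace EnrichedMatrix

variable {m n : ℕ} (A : EnrichedMatrix m n)

/-- Two rows are disjoint: they share no 1-column. -/
def RowDisj (i k : Fin m) : Prop := ∀ j, ¬(A.entry i j = true ∧ A.entry k j = true)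

/-- Row `i` is contained in row `k`. -/
def RowLe (i k : Fin m) : Prop := ∀ j, A.entry i j = true → A.entry k j = true

/-- Two rows are nested: one is contained in the other. -/
def RowNested (i k : Fin m) : Prop := A.RowLe i k ∨ A.RowLe k i

/-- A row is nonempty: it has at least one 1. -/
def RowNonempty (i : Fin m) : Prop := ∃ j, A.entry i j = true

/-- Rows `i` and `k` are both colored, with the same color. -/
def SameColor (i k : Fin m) : Prop := ∃ c, A.color i = some c ∧ A.color k = some c

/-- Rows `i` and `k` are both colored, with distinct colors. -/
def DistinctColors (i k : Fin m) : Prop :=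
  ∃ c d, A.color i = some c ∧ A.color k = some d ∧ c ≠ d

end EnrichedMatrix
namespace EnrichedMatrix

variable {m n : ℕ}

/-- `σ` is an LR-ordering of the columns of `A`: under the column order `σ 0, σ 1, …`,
the 1s of every non-LR-row are consecutive, the 1s of every L-row form an initial
segment, the 1s of every R-row form a final segment, and the 0s of every LR-row are
consecutive. -/
def IsLROrdering (A : EnrichedMatrix m n) (σ : Equiv.Perm (Fin n)) : Prop :=
  (∀ i, A.label i ≠ some RowLabel.LR → ∀ a b c : Fin n, a ≤ b → b ≤ c →
      A.entry i (σ a) = true → A.entry i (σ c) = true → A.entry i (σ b) = true) ∧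
  (∀ i, A.label i = some RowLabel.L → ∀ p q : Fin n, q ≤ p →
      A.entry i (σ p) = true → A.entry i (σ q) = true) ∧
  (∀ i, A.label i = some RowLabel.R → ∀ p q : Fin n, p ≤ q →
      A.entry i (σ p) = true → A.entry i (σ q) = true) ∧
  (∀ i, A.label i = some RowLabel.LR → ∀ a b c : Fin n, a ≤ b → b ≤ c →
      A.entry i (σ a) = false → A.entry i (σ c) = false → A.entry i (σ b) = false)

/-- `A` admits an LR-ordering. -/
def LROrderable (A : EnrichedMatrix m n) : Prop := ∃ σ : Equiv.Perm (Fin n), A.IsLROrdering σ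

/-- Position `p` (w.r.t. the column ordering `σ`) belongs to the L-block of row `i`:
row `i` has 1s in all positions up to and including `p`. -/
def InLBlock (A : EnrichedMatrix m n) (σ : Equiv.Perm (Fin n)) (i : Fin m) (p : Fin n) : Prop :=
  ∀ q : Fin n, q ≤ p → A.entry i (σ q) = true

/-- Position `p` (w.r.t. the column ordering `σ`) belongs to the R-block of row `i`:
row `i` has 1s in all positions from `p` on. -/
def InRBlock (A : EnrichedMatrix m n) (σ : Equiv.Perm (Fin n)) (i : Fin m) (p : Fin n) : Prop :=
  ∀ q : Fin n, p ≤ q → A.entry i (σ q) = true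

/-- Position `p` belongs to the U-block of row `i`: row `i` has a 1 there. -/
def InUBlock (A : EnrichedMatrix m n) (σ : Equiv.Perm (Fin n)) (i : Fin m) (p : Fin n) : Prop :=
  A.entry i (σ p) = true

/-- Row `i` (labeled L or LR) has an L-block w.r.t. `σ`. -/
def HasLBlock (A : EnrichedMatrix m n) (σ : Equiv.Perm (Fin n)) (i : Fin m) : Prop :=
  (A.label i = some RowLabel.L ∨ A.label i = some RowLabel.LR) ∧ ∃ p, A.InLBlock σ i p

/-- Row `i` (labeled R or LR) has an R-block w.r.t. `σ`. -/
def HasRBlock (A : EnrichedMatrix m n) (σ : Equiv.Perm (Fin n)) (i : Fin m) : Prop :=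
  (A.label i = some RowLabel.R ∨ A.label i = some RowLabel.LR) ∧ ∃ p, A.InRBlock σ i p

/-- The LR-ordering `σ` of `A` is suitable: the L-block of each LR-row having exactly
two blocks is disjoint from every R-block, the R-block of each LR-row having exactly
two blocks is disjoint from every L-block, and for each LR-row every U-block is
disjoint from its L-block or disjoint from its R-block. -/
def SuitableLROrdering (A : EnrichedMatrix m n) (σ : Equiv.Perm (Fin n)) : Prop :=
  A.IsLROrdering σ ∧
  (∀ i, A.label i = some RowLabel.LR → A.HasLBlock σ i → A.HasRBlock σ i →
      (∃ p, A.entry i (σ p) = false) →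
      (∀ k, (A.label k = some RowLabel.R ∨ A.label k = some RowLabel.LR) →
        ∀ p, ¬(A.InLBlock σ i p ∧ A.InRBlock σ k p)) ∧
      (∀ k, (A.label k = some RowLabel.L ∨ A.label k = some RowLabel.LR) →
        ∀ p, ¬(A.InRBlock σ i p ∧ A.InLBlock σ k p))) ∧
  (∀ i, A.label i = some RowLabel.LR → ∀ k, A.label k = none →
      (∀ p, ¬(A.InLBlock σ i p ∧ A.InUBlock σ k p)) ∨
      (∀ p, ¬(A.InRBlock σ i p ∧ A.InUBlock σ k p)))

end EnrichedMatrix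

namespace EnrichedMatrix

/-- A total block bi-coloring of an enriched matrix `A`: an LR-ordering `σ` together
with an assignment of a color to every block (the L-block, R-block and U-block of each
row, where meaningful) satisfying conditions (1)–(9) of the definition of 2-nested
matrices. -/
structure TotalBlockBicoloring {m n : ℕ} (A : EnrichedMatrix m n) : Type where
  /-- the LR-ordering of the columns -/
  σ : Equiv.Perm (Fin n)
  ord : A.IsLROrdering σ
  /-- color of the L-block of each row (meaningful for rows having an L-block) -/
  colL : Fin m → RowColor
  /-- color of the R-block of each row (meaningful for rows having an R-block) -/
  colR : Fin m → RowColor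
  /-- color of the U-block of each unlabeled row -/
  colU : Fin m → RowColor
  /-- (1) if an LR-row has an L-block and an R-block, they are colored distinctly -/
  cond1 : ∀ i, A.label i = some RowLabel.LR → A.HasLBlock σ i → A.HasRBlock σ i →
    colL i ≠ colR i
  /-- (2) the only block of a nonempty colored (L-) row has the color of the row -/
  cond2L : ∀ i c, A.RowNonempty i → A.color i = some c → A.label i = some RowLabel.L →
    colL i = c
  /-- (2) the only block of a nonempty colored (R-) row has the color of the row -/
  cond2R : ∀ i c, A.RowNonempty i → A.color i = some c → A.label i = some RowLabel.R →
    colR i = c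
  /-- (3) an L-block of an LR-row properly contained in the L-block of an L-row gets a
  different color -/
  cond3L : ∀ i k, A.label i = some RowLabel.LR → A.label k = some RowLabel.L →
    A.HasLBlock σ i → A.HasLBlock σ k →
    (∀ p, A.InLBlock σ i p → A.InLBlock σ k p) →
    (∃ p, A.InLBlock σ k p ∧ ¬ A.InLBlock σ i p) →
    colL i ≠ colL k
  /-- (3) an R-block of an LR-row properly contained in the R-block of an R-row gets a
  different color -/
  cond3R : ∀ i k, A.label i = some RowLabel.LR → A.label k = some RowLabel.R →
    A.HasRBlock σ i → A.HasRBlock σ k →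
    (∀ p, A.InRBlock σ i p → A.InRBlock σ k p) →
    (∃ p, A.InRBlock σ k p ∧ ¬ A.InRBlock σ i p) →
    colR i ≠ colR k
  /-- (4) every L-block of an LR-row is disjoint from every R-block -/
  cond4L : ∀ i k, A.label i = some RowLabel.LR →
    (A.label k = some RowLabel.R ∨ A.label k = some RowLabel.LR) →
    ∀ p, ¬(A.InLBlock σ i p ∧ A.InRBlock σ k p)
  /-- (4) every R-block of an LR-row is disjoint from every L-block -/
  cond4R : ∀ i k, A.label i = some RowLabel.LR →
    (A.label k = some RowLabel.L ∨ A.label k = some RowLabel.LR) →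
    ∀ p, ¬(A.InRBlock σ i p ∧ A.InLBlock σ k p)
  /-- (5) a non-disjoint L-block and R-block are colored distinctly -/
  cond5 : ∀ i k, (A.label i = some RowLabel.L ∨ A.label i = some RowLabel.LR) →
    (A.label k = some RowLabel.R ∨ A.label k = some RowLabel.LR) →
    (∃ p, A.InLBlock σ i p ∧ A.InRBlock σ k p) → colL i ≠ colR k
  /-- (6) two U-blocks of the same color are disjoint or nested -/
  cond6 : ∀ i k, A.label i = none → A.label k = none → colU i = colU k →
    (∀ p, ¬(A.InUBlock σ i p ∧ A.InUBlock σ k p)) ∨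
    (∀ p, A.InUBlock σ i p → A.InUBlock σ k p) ∨
    (∀ p, A.InUBlock σ k p → A.InUBlock σ i p)
  /-- (7) an L-block and a U-block of the same color are disjoint, or the U-block is
  contained in the L-block -/
  cond7L : ∀ i k, (A.label i = some RowLabel.L ∨ A.label i = some RowLabel.LR) →
    A.label k = none → colL i = colU k →
    (∀ p, ¬(A.InLBlock σ i p ∧ A.InUBlock σ k p)) ∨
    (∀ p, A.InUBlock σ k p → A.InLBlock σ i p)
  /-- (7) an R-block and a U-block of the same color are disjoint, or the U-block is
  contained in the R-block -/
  cond7R : ∀ i k, (A.label i = some RowLabel.R ∨ A.label i = some RowLabel.LR) →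
    A.label k = none → colR i = colU k →
    (∀ p, ¬(A.InRBlock σ i p ∧ A.InUBlock σ k p)) ∨
    (∀ p, A.InUBlock σ k p → A.InRBlock σ i p)
  /-- (8) if two L-blocks of non-LR-rows are colored distinctly, every LR-row has an
  L-block -/
  cond8L : ∀ i k, A.label i = some RowLabel.L → A.label k = some RowLabel.L →
    A.HasLBlock σ i → A.HasLBlock σ k → colL i ≠ colL k →
    ∀ r, A.label r = some RowLabel.LR → A.HasLBlock σ r
  /-- (8) if two R-blocks of non-LR-rows are colored distinctly, every LR-row has an
  R-block -/
  cond8R : ∀ i k, A.label i = some RowLabel.R → A.label k = some RowLabel.R →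
    A.HasRBlock σ i → A.HasRBlock σ k → colR i ≠ colR k →
    ∀ r, A.label r = some RowLabel.LR → A.HasRBlock σ r
  /-- (9) if two LR-rows overlap, the L-block of one and the R-block of the other have
  the same color -/
  cond9 : ∀ i k, A.label i = some RowLabel.LR → A.label k = some RowLabel.LR →
    A.RowNonempty i → A.RowNonempty k → ¬ A.RowDisj i k → ¬ A.RowNested i k →
    colL i = colR k

/-- An enriched matrix is 2-nested if it admits a total block bi-coloring. -/
def TwoNested {m n : ℕ} (A : EnrichedMatrix m n) : Prop :=
  Nonempty A.TotalBlockBicoloring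

end EnrichedMatrix

namespace EnrichedMatrix

/-- `A` contains `D_1` (or, equivalently up to permutations, its dual) as a
subconfiguration: a row labeled L and a row labeled R, colored with the same color,
sharing a 1-column. -/
def ContainsD1 {m n : ℕ} (A : EnrichedMatrix m n) : Prop :=
  ∃ (i₁ i₂ : Fin m) (j : Fin n),
    A.label i₁ = some RowLabel.L ∧ A.label i₂ = some RowLabel.R ∧
    A.SameColor i₁ i₂ ∧ A.entry i₁ j = true ∧ A.entry i₂ j = true

/-- `A` contains `D_5` (or, equivalently up to permutations, its dual) as a
subconfiguration: a row labeled L and a row labeled R colored with distinct colors,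
and an uncolored LR-row, all three sharing a 1-column. -/
def ContainsD5 {m n : ℕ} (A : EnrichedMatrix m n) : Prop :=
  ∃ (i₁ i₂ i₃ : Fin m) (j : Fin n),
    A.label i₁ = some RowLabel.L ∧ A.label i₂ = some RowLabel.R ∧
    A.DistinctColors i₁ i₂ ∧ A.label i₃ = some RowLabel.LR ∧ A.color i₃ = none ∧
    A.entry i₁ j = true ∧ A.entry i₂ j = true ∧ A.entry i₃ j = true

/-- `D` is (an instance of) the enriched matrix `D_1`. -/
def IsD1 (D : EnrichedMatrix 2 1) : Prop :=
  D.entry 0 0 = true ∧ D.entry 1 0 = true ∧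
  D.label 0 = some RowLabel.L ∧ D.label 1 = some RowLabel.R ∧ D.SameColor 0 1

/-- `D` is (an instance of) the enriched matrix `D_5`. -/
def IsD5 (D : EnrichedMatrix 3 1) : Prop :=
  (∀ i : Fin 3, D.entry i 0 = true) ∧
  D.label 0 = some RowLabel.L ∧ D.label 1 = some RowLabel.R ∧
  D.label 2 = some RowLabel.LR ∧ D.color 2 = none ∧ D.DistinctColors 0 1

end EnrichedMatrix

namespace EnrichedMatrix

variable {m n : ℕ} {A : EnrichedMatrix m n} {σ : Equiv.Perm (Fin n)}

/-- In an LR-ordering, a 1-column of an L-row belongs to its L-block. -/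
theorem IsLROrdering.inLBlock (h : A.IsLROrdering σ) {i : Fin m}
    (hi : A.label i = some RowLabel.L) {p : Fin n} (hp : A.entry i (σ p) = true) :
    A.InLBlock σ i p :=
  fun q hq => h.2.1 i hi p q hq hp

/-- In an LR-ordering, a 1-column of an R-row belongs to its R-block. -/
theorem IsLROrdering.inRBlock (h : A.IsLROrdering σ) {i : Fin m}
    (hi : A.label i = some RowLabel.R) {p : Fin n} (hp : A.entry i (σ p) = true) :
    A.InRBlock σ i p :=
  fun q hq => h.2.2.1 i hi p q hq hp

/-- In an LR-ordering, a 1-column of an LR-row belongs to its L-block or to its R-block. -/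
theorem IsLROrdering.inLBlock_or_inRBlock (h : A.IsLROrdering σ) {i : Fin m}
    (hi : A.label i = some RowLabel.LR) {p : Fin n} (hp : A.entry i (σ p) = true) :
    A.InLBlock σ i p ∨ A.InRBlock σ i p := by
  by_contra hcon
  obtain ⟨hL, hR⟩ := not_or.mp hcon
  simp only [InLBlock, InRBlock, not_forall, Bool.not_eq_true] at hL hR
  obtain ⟨a, hap, ha⟩ := hL
  obtain ⟨c, hpc, hc⟩ := hR
  simp [h.2.2.2 i hi a p c hap hpc ha hc] at hp

theorem TwoNested.not_containsD1 (hA : A.TwoNested) : ¬ A.ContainsD1 := by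
  obtain ⟨T⟩ := hA
  rintro ⟨i, k, j, hi, hk, ⟨c, hci, hck⟩, hij, hkj⟩
  have hL : T.colL i = c := T.cond2L i c ⟨j, hij⟩ hci hi
  have hR : T.colR k = c := T.cond2R k c ⟨j, hkj⟩ hck hk
  refine T.cond5 i k (.inl hi) (.inl hk) ⟨T.σ.symm j, ?_, ?_⟩ (hL.trans hR.symm)
  · exact T.ord.inLBlock hi (by simpa using hij)
  · exact T.ord.inRBlock hk (by simpa using hkj)

theorem TwoNested.not_containsD5 (hA : A.TwoNested) : ¬ A.ContainsD5 := by
  obtain ⟨T⟩ := hA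
  rintro ⟨i, k, r, j, hi, hk, -, hr, -, hij, hkj, hrj⟩
  have hiL : A.InLBlock T.σ i (T.σ.symm j) := T.ord.inLBlock hi (by simpa using hij)
  have hkR : A.InRBlock T.σ k (T.σ.symm j) := T.ord.inRBlock hk (by simpa using hkj)
  have hrj' : A.entry r (T.σ (T.σ.symm j)) = true := by simpa using hrj
  rcases T.ord.inLBlock_or_inRBlock hr hrj' with hrL | hrR
  · exact T.cond4L r k hr (.inl hk) _ ⟨hrL, hkR⟩
  · exact T.cond4R r i hr (.inl hi) _ ⟨hrR, hiL⟩

theorem IsD1.containsD1 {D : EnrichedMatrix 2 1} (hD : D.IsD1) : D.ContainsD1 := by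
  obtain ⟨h0, h1, hL, hR, hc⟩ := hD
  exact ⟨0, 1, 0, hL, hR, hc, h0, h1⟩

theorem IsD5.containsD5 {D : EnrichedMatrix 3 1} (hD : D.IsD5) : D.ContainsD5 := by
  obtain ⟨h, hL, hR, hLR, hu, hc⟩ := hD
  exact ⟨0, 1, 2, 0, hL, hR, hc, hLR, hu, h 0, h 1, h 2⟩

end EnrichedMatrix

/-- No 2-nested enriched matrix contains `D_1` or `D_5`, or their duals, as a
subconfiguration; in particular, neither `D_1` nor `D_5` admits a total block
bi-coloring. -/
theorem two_nested_no_D1_D5 :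
    (∀ (m n : ℕ) (A : EnrichedMatrix m n), A.TwoNested →
      ¬ A.ContainsD1 ∧ ¬ A.ContainsD5) ∧
    (∀ D : EnrichedMatrix 2 1, D.IsD1 → ¬ D.TwoNested) ∧
    (∀ D : EnrichedMatrix 3 1, D.IsD5 → ¬ D.TwoNested) := by
  exact ⟨fun _ _ _ hA => ⟨hA.not_containsD1, hA.not_containsD5⟩,
    fun _ hD hA => hA.not_containsD1 hD.containsD1,
    fun _ hD hA => hA.not_containsD5 hD.containsD5⟩
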